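/- arXiv:2112.04166 — 2 statements merged into one kernel-verified Lean document; each statement's English description precedes it below -/
import Mathlib

section
/- For any distinct x, x' ∈ [0,1], there exists an instance and an allocation in it that satisfies WEF(x, 1−x) but does not satisfy WPROP(x', 1−x'). -/
open Finset

/-- An allocation: a partition of the item set `Fin m` into `n` (possibly empty) bundles. -/
def IsAllocation {n m : ℕ} (A : Fin n → Finset (Fin m)) : Prop :=
  (∀ i j : Fin n, i ≠ j → Disjoint (A i) (A j)) ∧
    Finset.univ.biUnion A = (Finset.univ : Finset (Fin m))

/-- Additive utility of agent `i` for a bundle `S`. -/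
def util {n m : ℕ} (u : Fin n → Fin m → ℝ) (i : Fin n) (S : Finset (Fin m)) : ℝ :=
  ∑ g ∈ S, u i g

/-- Weighted envy-freeness up to (x, y)-fraction of one item. -/
def WEF {n m : ℕ} (w : Fin n → ℝ) (u : Fin n → Fin m → ℝ) (A : Fin n → Finset (Fin m))
    (x y : ℝ) : Prop :=
  ∀ i j : Fin n, ∃ B : Finset (Fin m), B ⊆ A j ∧ B.card ≤ 1 ∧
    (util u i (A i) + y * util u i B) / w i ≥ (util u i (A j) - x * util u i B) / w j

/-- Weighted proportionality up to (x, y)-fraction of one item. -/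
def WPROP {n m : ℕ} (w : Fin n → ℝ) (u : Fin n → Fin m → ℝ) (A : Fin n → Finset (Fin m))
    (x y : ℝ) : Prop :=
  ∀ i : Fin n, ∃ B : Finset (Fin m), B ⊆ Finset.univ \ A i ∧ B.card ≤ 1 ∧
    (util u i (A i) + y * util u i B) / w i ≥
      (util u i Finset.univ - (n : ℝ) * x * util u i B) / (∑ j, w j)

/-- The stronger notion WPROP*(x,y). -/
def WPROPstar {n m : ℕ} (w : Fin n → ℝ) (u : Fin n → Fin m → ℝ) (A : Fin n → Finset (Fin m))
    (x y : ℝ) : Prop :=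
  ∀ i : Fin n, ∃ B : Finset (Fin m), B ⊆ Finset.univ \ A i ∧ B.card ≤ 1 ∧
    ∃ Bf : Fin n → Finset (Fin m),
      (∀ j : Fin n, j ≠ i → Bf j ⊆ A j ∧ (Bf j).card ≤ 1) ∧
      (util u i (A i) + y * util u i B) / w i ≥
        (util u i Finset.univ - x * ∑ j ∈ Finset.univ.erase i, util u i (Bf j)) / (∑ j, w j)

/-- The (1-out-of-n) maximin share of agent `i`. -/
noncomputable def MMS {n m : ℕ} (u : Fin n → Fin m → ℝ) (i : Fin n) : ℝ :=
  sSup {v : ℝ | ∃ Z : Fin n → Finset (Fin m), IsAllocation Z ∧ v = ⨅ j, util u i (Z j)}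

/-- The normalized maximin share of agent `i`. -/
noncomputable def NMMS {n m : ℕ} (w : Fin n → ℝ) (u : Fin n → Fin m → ℝ) (i : Fin n) : ℝ :=
  (w i / ∑ j, w j) * (n : ℝ) * MMS u i

/-- The weighted maximin share of agent `i`. -/
noncomputable def WMMS {n m : ℕ} (w : Fin n → ℝ) (u : Fin n → Fin m → ℝ) (i : Fin n) : ℝ :=
  w i * sSup {v : ℝ | ∃ Z : Fin n → Finset (Fin m), IsAllocation Z ∧
    v = ⨅ j, util u i (Z j) / w j}

/-- For distinct x, x' ∈ [0,1], WEF(x,1−x) does not imply WPROP(x',1−x'). -/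
theorem wef_not_implies_wprop (x x' : ℝ)
    (hx : x ∈ Set.Icc (0 : ℝ) 1) (hx' : x' ∈ Set.Icc (0 : ℝ) 1) (hne : x ≠ x') :
    ∃ (n m : ℕ) (w : Fin n → ℝ) (u : Fin n → Fin m → ℝ) (A : Fin n → Finset (Fin m)),
      2 ≤ n ∧ (∀ i, 0 < w i) ∧ (∀ i g, 0 ≤ u i g) ∧ IsAllocation A ∧
      WEF w u A x (1 - x) ∧ ¬ WPROP w u A x' (1 - x') := by
  obtain ⟨hx0, hx1⟩ := hx
  obtain ⟨hy0, hy1⟩ := hx'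
  rcases lt_or_gt_of_ne hne with hlt | hgt
  · skip
    have hd : 0 < x' - x := by linarith
    have h1x : 0 < 1 - x := by linarith
    obtain ⟨k, hk⟩ := exists_nat_gt (1 + 1 / (x' - x))
    have hinv : 0 < 1 / (x' - x) := by positivity
    have hk1 : (1 : ℝ) < k := by linarith
    have hkd : (x' - x) + 1 < k * (x' - x) := by
      have h := mul_lt_mul_of_pos_right hk hd
      have h2 : (1 + 1 / (x' - x)) * (x' - x) = (x' - x) + 1 := by field_simp
      linarith
    have hkpos : 0 < k := by
      have : (0 : ℝ) < k := by linarith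
      exact_mod_cast this
    obtain ⟨v, hv⟩ : ∃ v : ℝ, v = (k - x) / (1 - x) := ⟨_, rfl⟩
    have hvx : v * (1 - x) = k - x := by rw [hv]; field_simp
    have hvk : (k : ℝ) ≤ v := by
      rw [hv, le_div_iff₀ h1x]; nlinarith
    have hv0 : 0 < v := by linarith
    refine ⟨2, k, ![1, v], fun i _ => if i = 0 then 1 else 0, ![∅, Finset.univ], le_rfl,
      ?_, ?_, ?_, ?_, ?_⟩
    · intro i; fin_cases i <;> simp [hv0]
    · intro i g; dsimp only; split_ifs <;> norm_num
    · refine ⟨?_, ?_⟩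
      · intro i j hij; fin_cases i <;> fin_cases j <;> simp_all
      · ext g; simp
    · intro i j
      fin_cases i <;> fin_cases j
      · exact ⟨∅, by simp, by simp, by simp [util]⟩
      · refine ⟨{⟨0, hkpos⟩}, by simp, by simp, ?_⟩
        simp [util]
        rw [div_le_iff₀ hv0]; linarith
      · exact ⟨∅, by simp, by simp, by simp [util]⟩
      · exact ⟨∅, by simp, by simp, by simp [util]⟩
    · intro h
      obtain ⟨B, -, hB, h⟩ := h 0
      simp [util] at h
      rw [div_le_iff₀ (by linarith)] at h
      have hb : (B.card : ℝ) ≤ 1 := by exact_mod_cast hB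
      have hb0 : (0 : ℝ) ≤ B.card := by positivity
      have e1 : 0 ≤ (1 - (B.card : ℝ)) * ((1 - x') * (1 + v) + 2 * x') := by
        apply mul_nonneg (by linarith)
        have : 0 ≤ (1 - x') * (1 + v) := mul_nonneg (by linarith) (by linarith)
        linarith
      have e2 : (k : ℝ) * (x' - x) ≤ v * (x' - x) := mul_le_mul_of_nonneg_right hvk hd.le
      nlinarith
  · have hd : 0 < x - x' := by linarith
    obtain ⟨N, hN⟩ := exists_nat_gt (2 / (x - x'))
    have hNd : 2 < N * (x - x') := by rwa [div_lt_iff₀ hd] at hN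
    refine ⟨N + 1, N + 1, fun i => if i = 0 then 1 else 1 / 2,
      fun i g => if i = 0 then (if g = 0 then 1 - x else 1) else 0, fun i => {i}, ?_,
      ?_, ?_, ?_, ?_, ?_⟩
    · have : N ≠ 0 := by
        rintro rfl
        norm_num at hNd
      omega
    · intro i; dsimp only; split_ifs <;> norm_num
    · intro i g; dsimp only; split_ifs <;> linarith
    · refine ⟨?_, ?_⟩
      · intro i j hij; simpa using hij
      · ext g; simp
    · intro i j
      by_cases hij : i = j
      · subst hij
        exact ⟨∅, by simp, by simp, by simp [util]⟩
      · refine ⟨{j}, by simp, by simp, ?_⟩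
        by_cases hi : i = 0
        · subst hi
          have hj : j ≠ 0 := fun h => hij h.symm
          simp [util, hj]
          linarith
        · simp [util, hi]
    · intro h
      obtain ⟨B, hBs, hB, h⟩ := h 0
      have hub : util (fun (i g : Fin (N + 1)) => if i = 0 then (if g = 0 then 1 - x else 1) else 0)
          0 B = B.card := by
        have : ∀ g ∈ B, g ≠ 0 := by
          intro g hg
          simpa using hBs hg
        unfold util
        rw [Finset.sum_congr rfl (g := fun _ => (1 : ℝ))]
        · simp
        · intro g hg
          simp [this g hg]
      rw [hub] at h
      simp [util, Fin.sum_univ_succ] at h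
      have hb : (B.card : ℝ) ≤ 1 := by exact_mod_cast hB
      have hN0 : (0 : ℝ) ≤ N := by positivity
      rw [div_le_iff₀ (by positivity)] at h
      have e1 : 0 ≤ (1 - (B.card : ℝ)) * ((1 - x') * (1 + N * 2⁻¹) + (N + 1) * x') := by
        apply mul_nonneg (by linarith)
        have : 0 ≤ (1 - x') * (1 + N * 2⁻¹) := mul_nonneg (by linarith) (by positivity)
        have : 0 ≤ (N + 1) * x' := by positivity
        linarith
      nlinarith
end

section
/- If an instance satisfies u_i(g) ≤ NMMS_i for every agent i and every item g, then there exists a 1/2-NMMS allocation. -/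
open Finset

/-- Greedy allocation: correctness of the remaining part of the process. -/
lemma greedy_aux {n m : ℕ} (w : Fin n → ℝ) (v : Fin n → Fin m → ℝ)
    (hv : ∀ i g, 0 ≤ v i g) (hw : ∀ i, 0 < w i) (hn : 0 < n) :
    ∀ (k : ℕ) (R : Finset (Fin m)) (S : Finset (Fin n)) (c : Fin n → ℝ), R.card = k →
      (∀ i ∈ S, c i < w i / 2) →
      (∀ i ∈ S, ∀ g ∈ R, v i g + c i ≤ w i) →
      (∀ i ∈ S, c i = 0 ∨ ∀ g ∈ R, v i g ≤ w i / 2) →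
      (∀ i ∈ S, ∑ j ∈ S, w j ≤ ∑ g ∈ R, v i g + ∑ j ∈ S, c j) →
      ∃ f : Fin m → Fin n, ∀ i ∈ S, w i / 2 ≤ c i + ∑ g ∈ R with f g = i, v i g := by
  intro k
  induction k with
  | zero =>
    intro R S c hR hc _ _ hsum
    refine ⟨fun _ => ⟨0, hn⟩, ?_⟩
    intro i hi
    exfalso
    have h1 := hsum i hi
    rw [Finset.card_eq_zero.mp hR] at h1
    have h2 : ∑ j ∈ S, c j < ∑ j ∈ S, w j :=
      Finset.sum_lt_sum_of_nonempty ⟨i, hi⟩ (fun j hj => by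
        have := hc j hj
        have := hw j
        linarith)
    simp at h1
    linarith
  | succ k ih =>
    intro R S c hR hc hle hor hsum
    rcases S.eq_empty_or_nonempty with rfl | hS
    · exact ⟨fun _ => ⟨0, hn⟩, by simp⟩
    have hRne : R.Nonempty := by
      rw [← Finset.card_pos]; omega
    obtain ⟨⟨j, g⟩, hjg, hmax⟩ :=
      Finset.exists_max_image (S ×ˢ R) (fun p => v p.1 p.2) (hS.product hRne)
    rw [Finset.mem_product] at hjg
    obtain ⟨hj, hg⟩ := hjg
    simp only at hj hg
    have hmax' : ∀ i ∈ S, ∀ h ∈ R, v i h ≤ v j g := fun i hi h hh =>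
      hmax (i, h) (Finset.mem_product.mpr ⟨hi, hh⟩)
    have hcard : (R.erase g).card = k := by
      rw [Finset.card_erase_of_mem hg]; omega
    have hsplit : ∀ i, v i g + ∑ h ∈ R.erase g, v i h = ∑ h ∈ R, v i h := fun i =>
      Finset.add_sum_erase R (fun h => v i h) hg
    have hext : ∀ (f : Fin m → Fin n) (i : Fin n),
        ∑ h ∈ R with Function.update f g j h = i, v i h =
          (if j = i then v i g else 0) + ∑ h ∈ R.erase g with f h = i, v i h := by
      intro f i
      rw [Finset.sum_filter, Finset.sum_filter, ← Finset.add_sum_erase R _ hg]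
      congr 1
      · simp
      · apply Finset.sum_congr rfl
        intro h hh
        rw [Function.update_of_ne (Finset.ne_of_mem_erase hh)]
    by_cases hdone : w j / 2 ≤ c j + v j g
    · obtain ⟨f, hf⟩ := ih (R.erase g) (S.erase j) c hcard
        (fun i hi => hc i (Finset.mem_of_mem_erase hi))
        (fun i hi h hh => hle i (Finset.mem_of_mem_erase hi) h (Finset.mem_of_mem_erase hh))
        (fun i hi => (hor i (Finset.mem_of_mem_erase hi)).imp id
          (fun H h hh => H h (Finset.mem_of_mem_erase hh)))
        (by
          intro i hi
          have hi' := Finset.mem_of_mem_erase hi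
          have h1 := hsum i hi'
          have h2 := hsplit i
          have h3 := Finset.add_sum_erase S w hj
          have h4 := Finset.add_sum_erase S c hj
          have h5 := hmax' i hi' g hg
          have h6 := hle j hj g hg
          linarith)
      refine ⟨Function.update f g j, ?_⟩
      intro i hi
      rw [hext]
      by_cases hij : j = i
      · subst hij
        have : 0 ≤ ∑ h ∈ R.erase g with f h = j, v j h :=
          Finset.sum_nonneg (fun h _ => hv j h)
        simp only [if_true]
        linarith
      · have := hf i (Finset.mem_erase.mpr ⟨fun h => hij h.symm, hi⟩)
        simp only [if_neg hij]
        linarith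
    · push Not at hdone
      have hcj : 0 ≤ v j g := hv j g
      have hupd : ∑ i ∈ S, Function.update c j (c j + v j g) i = ∑ i ∈ S, c i + v j g := by
        rw [← Finset.add_sum_erase S _ hj, ← Finset.add_sum_erase S c hj]
        rw [Finset.sum_congr rfl (fun i hi =>
          Function.update_of_ne (Finset.ne_of_mem_erase hi) (c j + v j g) c)]
        simp only [Function.update_self]
        ring
      have hvj : ∀ h ∈ R, v j h ≤ w j / 2 := by
        intro h hh
        rcases hor j hj with h0 | H
        · have := hmax' j hj h hh
          linarith
        · exact H h hh
      obtain ⟨f, hf⟩ := ih (R.erase g) S (Function.update c j (c j + v j g)) hcard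
        (by
          intro i hi
          by_cases hij : i = j
          · subst hij; simpa using hdone
          · rw [Function.update_of_ne hij]; exact hc i hi)
        (by
          intro i hi h hh
          by_cases hij : i = j
          · subst hij
            have := hvj h (Finset.mem_of_mem_erase hh)
            simp only [Function.update_self]
            linarith
          · rw [Function.update_of_ne hij]
            exact hle i hi h (Finset.mem_of_mem_erase hh))
        (by
          intro i hi
          by_cases hij : i = j
          · subst hij
            exact Or.inr (fun h hh => hvj h (Finset.mem_of_mem_erase hh))
          · rw [Function.update_of_ne hij]
            exact (hor i hi).imp id (fun H h hh => H h (Finset.mem_of_mem_erase hh)))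
        (by
          intro i hi
          have h1 := hsum i hi
          have h2 := hsplit i
          have h5 := hmax' i hi g hg
          rw [hupd]
          linarith)
      refine ⟨Function.update f g j, ?_⟩
      intro i hi
      rw [hext]
      have := hf i hi
      by_cases hij : j = i
      · subst hij
        simp only [Function.update_self] at this
        simp only [if_true]
        linarith
      · rw [Function.update_of_ne (fun h => hij h.symm)] at this
        simp only [if_neg hij]
        linarith

/-- The maximin share is at most the proportional share. -/
lemma card_mul_MMS_le {n m : ℕ} (hn : 0 < n) (u : Fin n → Fin m → ℝ)
    (hu : ∀ i g, 0 ≤ u i g) (i : Fin n) : (n : ℝ) * MMS u i ≤ ∑ g, u i g := by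
  have hn' : (0 : ℝ) < n := by exact_mod_cast hn
  have : MMS u i ≤ (∑ g, u i g) / n := by
    apply Real.sSup_le
    · rintro x ⟨Z, ⟨hdis, hun⟩, rfl⟩
      rw [le_div_iff₀ hn']
      have h1 : ∑ g, u i g = ∑ j, util u i (Z j) := by
        rw [← hun, Finset.sum_biUnion (fun a _ b _ hab => hdis a b hab)]
        rfl
      rw [h1]
      have h2 : ∑ _j : Fin n, (⨅ j, util u i (Z j)) ≤ ∑ j, util u i (Z j) :=
        Finset.sum_le_sum (fun j _ => ciInf_le (Set.finite_range _).bddBelow j)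
      simp at h2
      linarith
    · exact div_nonneg (Finset.sum_nonneg (fun g _ => hu i g)) hn'.le
  rw [le_div_iff₀ hn'] at this
  linarith

/-- If every item's value is at most the agent's NMMS, a 1/2-NMMS allocation exists. -/
theorem half_nmms_exists (n m : ℕ) (hn : 2 ≤ n)
    (w : Fin n → ℝ) (hw : ∀ i, 0 < w i)
    (u : Fin n → Fin m → ℝ) (hu : ∀ i g, 0 ≤ u i g)
    (hsmall : ∀ (i : Fin n) (g : Fin m), u i g ≤ NMMS w u i) :
    ∃ A : Fin n → Finset (Fin m), IsAllocation A ∧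
      ∀ i, util u i (A i) ≥ (1 / 2 : ℝ) * NMMS w u i := by
  have hn0 : 0 < n := by omega
  have hn' : (0 : ℝ) < n := by exact_mod_cast hn0
  have hW : 0 < ∑ j, w j :=
    Finset.sum_pos (fun j _ => hw j) ⟨⟨0, hn0⟩, Finset.mem_univ _⟩
  set W := ∑ j, w j with hWdef
  let S : Finset (Fin n) := Finset.univ.filter (fun i => 0 < MMS u i)
  let v : Fin n → Fin m → ℝ := fun i g => u i g * |W / (n * MMS u i)|
  have hS : ∀ i ∈ S, 0 < MMS u i := fun i hi => (Finset.mem_filter.mp hi).2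
  have hvS : ∀ i ∈ S, ∀ g, v i g = u i g * (W / (n * MMS u i)) := by
    intro i hi g
    have := hS i hi
    simp only [v]
    rw [abs_of_pos (by positivity)]
  have hNM : ∀ i ∈ S, NMMS w u i * (W / (n * MMS u i)) = w i := by
    intro i hi
    have := hS i hi
    simp only [NMMS, ← hWdef]
    field_simp
  have hpos : ∀ i ∈ S, 0 < W / (n * MMS u i) := by
    intro i hi
    have := hS i hi
    positivity
  have hvle : ∀ i ∈ S, ∀ g, v i g ≤ w i := by
    intro i hi g
    rw [hvS i hi, ← hNM i hi]
    exact mul_le_mul_of_nonneg_right (hsmall i g) (hpos i hi).le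
  obtain ⟨f, hf⟩ := greedy_aux w v (fun i g => mul_nonneg (hu i g) (abs_nonneg _)) hw hn0
    _ Finset.univ S (fun _ => 0) rfl
    (fun i _ => by have := hw i; linarith)
    (fun i hi g _ => by have := hvle i hi g; linarith)
    (fun i _ => Or.inl rfl)
    (by
      intro i hi
      have h1 : ∑ j ∈ S, w j ≤ W :=
        Finset.sum_le_sum_of_subset_of_nonneg (Finset.subset_univ _) (fun j _ _ => (hw j).le)
      have h2 : W ≤ ∑ g, v i g := by
        rw [Finset.sum_congr rfl (fun g _ => hvS i hi g), ← Finset.sum_mul]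
        have h3 := card_mul_MMS_le hn0 u hu i
        have h4 := mul_le_mul_of_nonneg_right h3 (hpos i hi).le
        have h5 : (n : ℝ) * MMS u i * (W / (n * MMS u i)) = W := by
          have := hS i hi
          field_simp
        linarith
      simp
      linarith)
  refine ⟨fun i => Finset.univ.filter (fun g => f g = i), ⟨?_, ?_⟩, ?_⟩
  · intro i j hij
    rw [Finset.disjoint_left]
    intro g h1 h2
    simp at h1 h2
    exact hij (h1.symm.trans h2)
  · ext g
    simp
  · intro i
    by_cases hi : i ∈ S
    · have h1 := hf i hi
      rw [Finset.sum_congr rfl (fun g _ => hvS i hi g), ← Finset.sum_mul, ← hNM i hi] at h1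
      have h2 : (1 / 2 * NMMS w u i) * (W / (n * MMS u i)) ≤
          util u i (Finset.univ.filter (fun g => f g = i)) * (W / (n * MMS u i)) := by
        unfold util
        linarith
      exact le_of_mul_le_mul_right h2 (hpos i hi)
    · have h0 : MMS u i ≤ 0 := by
        by_contra h
        exact hi (Finset.mem_filter.mpr ⟨Finset.mem_univ _, not_le.mp h⟩)
      have h1 : NMMS w u i ≤ 0 := by
        unfold NMMS
        apply mul_nonpos_of_nonneg_of_nonpos _ h0
        have := hw i
        positivity
      have h2 : 0 ≤ util u i (Finset.univ.filter (fun g => f g = i)) :=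
        Finset.sum_nonneg (fun g _ => hu i g)
      simp only [ge_iff_le]
      linarith
end
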